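/- For g = osp(1|2n)^{(1)} and any 1≤i,j≤n with i≠j, the vertex operators on V satisfy [X⁺_i(z), X⁻_j(w)] = 0 as formal series, where the bracket is the super-commutator; equivalently, for all mode indices k,l: X⁺_i(k)X⁻_j(l) = (−1)^{p_i p_j} X⁻_j(l)X⁺_i(k) as linear operators on V, where p_m = 1 if m = n and p_m = 0 otherwise. -/

import Mathlib

set_option synthInstance.maxHeartbeats 1000000
set_option maxHeartbeats 1000000

noncomputable section

open scoped BigOperators

/-! ## The base field and basic scalars -/

/-- The base field `K = ℂ(q^{1/2})`. -/
abbrev KK : Type := RatFunc ℂ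

/-- `q^{1/2}`. -/
def qh : KK := RatFunc.X

/-- integer powers of `q^{1/2}`. -/
def qpow (m : ℤ) : KK := qh ^ m

/-- a fixed square root of `−1`. -/
def ii : KK := RatFunc.C Complex.I

/-- The three series of affine Lie superalgebras. -/
inductive Gcase : Type
  | osp1  -- osp(1|2n)^{(1)}
  | sl2   -- sl(1|2n)^{(2)}
  | osp2  -- osp(2|2n)^{(2)}
deriving DecidableEq

/-! ## Root data (normalisation `(α_n, α_n) = 1`), affine indices `0, 1, …, n` -/

/-- The symmetric bilinear form `(α_i, α_j)` on the simple roots, paper indices `0 ≤ i,j ≤ n`. -/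
def Bc (c : Gcase) (n : ℕ) (i j : ℕ) : ℤ :=
  if i = j then
    (match c with
      | .osp1 => if i = 0 then 4 else if i = n then 1 else 2
      | .sl2 => if i = n then 1 else 2
      | .osp2 => if i = 0 ∨ i = n then 1 else 2)
  else if i + 1 = j ∨ j + 1 = i then
    (match c with
      | .osp1 => if i = 0 ∨ j = 0 then -2 else -1
      | .sl2 => if i = 0 ∨ j = 0 then 0 else -1
      | .osp2 => -1)
  else if (i = 0 ∧ j = 2) ∨ (j = 0 ∧ i = 2) then
    (match c with | .sl2 => -1 | _ => 0)
  else 0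

/-- Parity of the simple root `α_i` (`1` = odd, `0` = even). -/
def pc (c : Gcase) (n : ℕ) (i : ℕ) : ℕ :=
  match c with
  | .osp2 => if i = 0 ∨ i = n then 1 else 0
  | _ => if i = n then 1 else 0

/-- The structure constants `u_{i,j,r}` of the Drinfeld realisation (paper indices `1 ≤ i,j ≤ n`). -/
def uconst (c : Gcase) (n : ℕ) (i j : ℕ) (r : ℤ) : KK :=
  match c with
  | .osp1 =>
      if i = n ∧ j = n then qpow (4 * r) - qpow (-(4 * r)) - qpow (2 * r) + qpow (-(2 * r))
      else qpow (2 * r * Bc c n i j) - qpow (-(2 * r * Bc c n i j))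
  | .sl2 =>
      if i = n ∧ j = n then ((-1 : KK) ^ r) * (qpow (2 * r) - qpow (-(2 * r)))
      else qpow (2 * r * Bc c n i j) - qpow (-(2 * r * Bc c n i j))
  | .osp2 =>
      if i = n ∧ j = n then ((-1 : KK) ^ r) * (qpow (2 * r) - qpow (-(2 * r)))
      else (1 + (-1 : KK) ^ r) * (qpow (r * Bc c n i j) - qpow (-(r * Bc c n i j)))

/-! ## The Drinfeld superalgebra `U_q^D(g)` -/

/-- Generators of the Drinfeld superalgebra: `ξ⁺_{i,r}`, `ξ⁻_{i,r}`, `γ_i`, `γ_i⁻¹`, `κ_{i,s}`,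
`γ^{1/2}`, `γ^{−1/2}`.  Here `i : Fin n` stands for the paper's index `i + 1 ∈ {1, …, n}`. -/
inductive DGen (n : ℕ) : Type
  | xp : Fin n → ℤ → DGen n
  | xm : Fin n → ℤ → DGen n
  | ga : Fin n → DGen n
  | gai : Fin n → DGen n
  | ka : Fin n → ℤ → DGen n
  | gh : DGen n
  | ghi : DGen n

/-- The free algebra on the Drinfeld generators. -/
abbrev DF (n : ℕ) : Type := FreeAlgebra KK (DGen n)

def dXp {n : ℕ} (i : Fin n) (r : ℤ) : DF n := FreeAlgebra.ι KK (DGen.xp i r)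
def dXm {n : ℕ} (i : Fin n) (r : ℤ) : DF n := FreeAlgebra.ι KK (DGen.xm i r)
def dGa {n : ℕ} (i : Fin n) : DF n := FreeAlgebra.ι KK (DGen.ga i)
def dGai {n : ℕ} (i : Fin n) : DF n := FreeAlgebra.ι KK (DGen.gai i)
def dKa {n : ℕ} (i : Fin n) (s : ℤ) : DF n := FreeAlgebra.ι KK (DGen.ka i s)
def dGh (n : ℕ) : DF n := FreeAlgebra.ι KK (DGen.gh : DGen n)
def dGhi (n : ℕ) : DF n := FreeAlgebra.ι KK (DGen.ghi : DGen n)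

/-- paper index of `i : Fin n`. -/
def pid {n : ℕ} (i : Fin n) : ℕ := (i : ℕ) + 1

def dB (c : Gcase) (n : ℕ) (i j : Fin n) : ℤ := Bc c n (pid i) (pid j)
def du (c : Gcase) (n : ℕ) (i j : Fin n) (r : ℤ) : KK := uconst c n (pid i) (pid j) r
/-- `q_i = q^{(α_i,α_i)/2}`. -/
def dqi (c : Gcase) (n : ℕ) (i : Fin n) : KK := qpow (dB c n i i)
/-- `q_i − q_i⁻¹`. -/
def dden (c : Gcase) (n : ℕ) (i : Fin n) : KK := dqi c n i - (dqi c n i)⁻¹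
/-- parity of `ξ^±_{i,r}`. -/
def dpar (n : ℕ) (i : Fin n) : ℕ := if pid i = n then 1 else 0
/-- the admissible index set `I_g`. -/
def dadm (c : Gcase) (n : ℕ) (i : Fin n) (r : ℤ) : Prop :=
  c ≠ .osp2 ∨ pid i = n ∨ r % 2 = 0
/-- `γ^{m/2}` as a word in the generators `γ^{±1/2}`. -/
def dgampow (n : ℕ) (m : ℤ) : DF n :=
  if 0 ≤ m then (dGh n) ^ m.toNat else (dGhi n) ^ (-m).toNat

/-- the Cartan integer `a_{ij} = 2(α_i,α_j)/(α_i,α_i)`. -/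
def dacart (c : Gcase) (n : ℕ) (i j : Fin n) : ℤ := 2 * dB c n i j / dB c n i i
/-- the shift `θ` in Serre relation (A). -/
def dtheta (c : Gcase) (n : ℕ) (i j : Fin n) : ℤ :=
  match c with
  | .osp2 => if pid i = n ∧ pid j = n then 1 else 2
  | _ => 1

/-- The elements `κ̂⁺_{i,m}`, defined from the `κ`'s by the exponential generating series
`Σ_{m≥0} κ̂⁺_{i,m} u^{−m} = γ_i exp((q_i−q_i⁻¹) Σ_{m>0} κ_{i,m} u^{−m})`, here characterised by
the equivalent recursion `(m+1) κ̂⁺_{i,m+1} = (q_i−q_i⁻¹) Σ_{r=1}^{m+1} r κ_{i,r} κ̂⁺_{i,m+1−r}`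
(valid since the `κ_{i,r}`, `r > 0`, commute), `κ̂⁺_{i,0} = γ_i`. -/
def khatp (c : Gcase) (n : ℕ) (i : Fin n) : ℕ → DF n
  | 0 => dGa i
  | (m + 1) =>
      (((m : KK) + 1))⁻¹ • (dden c n i •
        ∑ r ∈ Finset.range (m + 1),
          (((r : ℕ) + 1 : ℕ) : KK) • (dKa i ((r : ℤ) + 1) * khatp c n i (m - r)))
  decreasing_by exact Nat.lt_succ_of_le (Nat.sub_le m r)

/-- The elements `κ̂⁻_{i,−m}`, defined by
`Σ_{m≥0} κ̂⁻_{i,−m} u^{m} = γ_i⁻¹ exp((q_i⁻¹−q_i) Σ_{m>0} κ_{i,−m} u^{m})`. -/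
def khatm (c : Gcase) (n : ℕ) (i : Fin n) : ℕ → DF n
  | 0 => dGai i
  | (m + 1) =>
      (((m : KK) + 1))⁻¹ • ((-(dden c n i)) •
        ∑ r ∈ Finset.range (m + 1),
          (((r : ℕ) + 1 : ℕ) : KK) • (dKa i (-((r : ℤ) + 1)) * khatm c n i (m - r)))
  decreasing_by exact Nat.lt_succ_of_le (Nat.sub_le m r)

/-- `κ̂⁺_{i,r}` for `r : ℤ` (zero for `r < 0`). -/
def DKhatP (c : Gcase) (n : ℕ) (i : Fin n) (r : ℤ) : DF n :=
  if 0 ≤ r then khatp c n i r.toNat else 0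

/-- `κ̂⁻_{i,r}` for `r : ℤ` (zero for `r > 0`). -/
def DKhatM (c : Gcase) (n : ℕ) (i : Fin n) (r : ℤ) : DF n :=
  if r ≤ 0 then khatm c n i (-r).toNat else 0

/-- the twisted bracket `[x,y]_a = xy − (−1)^{[x][y]} a · yx` for homogeneous `x, y` of
parities `px, py`. -/
def sbr {n : ℕ} (px py : ℕ) (a : KK) (x y : DF n) : DF n :=
  x * y - (((-1 : KK) ^ (px * py)) * a) • (y * x)

/-- `[m]_z`. -/
def qint (z : KK) (m : ℕ) : KK := (z ^ m - z⁻¹ ^ m) / (z - z⁻¹)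
/-- `[m]_z!`. -/
def qfact (z : KK) : ℕ → KK
  | 0 => 1
  | (m + 1) => qint z (m + 1) * qfact z m
/-- the Gaussian binomial coefficient `[N; k]_z`. -/
def qbinom (z : KK) (N k : ℕ) : KK := qfact z N / (qfact z k * qfact z (N - k))

/-- `sym_{r_1,…,r_ℓ} Σ_{k=0}^{ℓ} coef k · A_{r_{σ(1)}} ⋯ A_{r_{σ(k)}} · b · A_{r_{σ(k+1)}} ⋯`. -/
def serreSum {n : ℕ} (ℓ : ℕ) (A : Fin ℓ → DF n) (b : DF n) (coef : ℕ → KK) : DF n :=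
  ∑ σ : Equiv.Perm (Fin ℓ), ∑ k ∈ Finset.range (ℓ + 1),
    coef k • (((List.ofFn fun m => A (σ m)).take k).prod * b *
      ((List.ofFn fun m => A (σ m)).drop k).prod)

/-- The defining relations of the Drinfeld superalgebra `U_q^D(g)` (Definition 2.2 of the
paper).  Non-admissible generators (which occur for `osp(2|2n)^{(2)}`) and the generators
`κ_{i,0}` are set to zero. -/
inductive DRel (c : Gcase) (n : ℕ) : DF n → DF n → Prop
  | killxp (i : Fin n) (r : ℤ) (h : ¬ dadm c n i r) : DRel c n (dXp i r) 0
  | killxm (i : Fin n) (r : ℤ) (h : ¬ dadm c n i r) : DRel c n (dXm i r) 0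
  | killka (i : Fin n) (r : ℤ) (h : ¬ dadm c n i r ∨ r = 0) : DRel c n (dKa i r) 0
  -- `γ^{±1/2}` central, mutually inverse
  | gh_ghi : DRel c n (dGh n * dGhi n) 1
  | ghi_gh : DRel c n (dGhi n * dGh n) 1
  | gh_central (g : DGen n) :
      DRel c n (dGh n * FreeAlgebra.ι KK g) (FreeAlgebra.ι KK g * dGh n)
  | ghi_central (g : DGen n) :
      DRel c n (dGhi n * FreeAlgebra.ι KK g) (FreeAlgebra.ι KK g * dGhi n)
  -- `γ_i` invertible, mutually commuting
  | ga_gai (i : Fin n) : DRel c n (dGa i * dGai i) 1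
  | gai_ga (i : Fin n) : DRel c n (dGai i * dGa i) 1
  | ga_comm (i j : Fin n) : DRel c n (dGa i * dGa j) (dGa j * dGa i)
  | ga_ka (i j : Fin n) (s : ℤ) : DRel c n (dGa i * dKa j s) (dKa j s * dGa i)
  -- `γ_i ξ^±_{j,r} γ_i⁻¹ = q_i^{± a_{ij}} ξ^±_{j,r}`
  | ga_xp (i j : Fin n) (r : ℤ) :
      DRel c n (dGa i * dXp j r * dGai i) (qpow (2 * dB c n i j) • dXp j r)
  | ga_xm (i j : Fin n) (r : ℤ) :
      DRel c n (dGa i * dXm j r * dGai i) (qpow (-(2 * dB c n i j)) • dXm j r)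
  -- `[κ_{i,r}, ξ^±_{j,s}] = (u_{i,j,r} γ^{∓|r|/2} / (r(q_i−q_i⁻¹))) ξ^±_{j,s+r}`
  | ka_xp (i j : Fin n) (r s : ℤ) (hr : r ≠ 0) :
      DRel c n (dKa i r * dXp j s - dXp j s * dKa i r)
        ((du c n i j r / ((r : KK) * dden c n i)) • (dgampow n (-|r|) * dXp j (s + r)))
  | ka_xm (i j : Fin n) (r s : ℤ) (hr : r ≠ 0) :
      DRel c n (dKa i r * dXm j s - dXm j s * dKa i r)
        ((du c n i j r / ((r : KK) * dden c n i)) • (dgampow n |r| * dXm j (s + r)))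
  -- `[κ_{i,r}, κ_{j,s}] = δ_{r+s,0} u_{i,j,r}(γ^r − γ^{−r})/(r(q_i−q_i⁻¹)(q_j−q_j⁻¹))`
  | ka_ka (i j : Fin n) (r s : ℤ) (hr : r ≠ 0) (hs : s ≠ 0) :
      DRel c n (dKa i r * dKa j s - dKa j s * dKa i r)
        (if s = -r then
          (du c n i j r / ((r : KK) * dden c n i * dden c n j)) •
            (dgampow n (2 * r) - dgampow n (-(2 * r)))
         else 0)
  -- `[ξ⁺_{i,r}, ξ⁻_{j,s}] = δ_{ij}(γ^{(r−s)/2} κ̂⁺_{i,r+s} − γ^{(s−r)/2} κ̂⁻_{i,r+s})/(q_i−q_i⁻¹)`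
  | xpxm (i j : Fin n) (r s : ℤ) :
      DRel c n (dXp i r * dXm j s - ((-1 : KK) ^ (dpar n i * dpar n j)) • (dXm j s * dXp i r))
        (if i = j then
          (dden c n i)⁻¹ •
            (dgampow n (r - s) * DKhatP c n i (r + s) - dgampow n (s - r) * DKhatM c n i (r + s))
         else 0)
  -- Serre relation (A)
  | serreA_p (i j : Fin n) (r s : ℤ) (h : ¬(c = Gcase.osp1 ∧ pid i = n ∧ pid j = n)) :
      DRel c n
        (sbr (dpar n i) (dpar n j) (qpow (2 * dB c n i j)) (dXp i (r + dtheta c n i j)) (dXp j s) +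
         sbr (dpar n j) (dpar n i) (qpow (2 * dB c n j i)) (dXp j (s + dtheta c n i j)) (dXp i r)) 0
  | serreA_m (i j : Fin n) (r s : ℤ) (h : ¬(c = Gcase.osp1 ∧ pid i = n ∧ pid j = n)) :
      DRel c n
        (sbr (dpar n i) (dpar n j) (qpow (2 * dB c n i j)) (dXm i (r - dtheta c n i j)) (dXm j s) +
         sbr (dpar n j) (dpar n i) (qpow (2 * dB c n j i)) (dXm j (s - dtheta c n i j)) (dXm i r)) 0
  -- Serre relation (B)
  | serreB_p (i j : Fin n) (hij : i ≠ j) (hi : pid i ≠ n)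
      (rv : Fin (1 - dacart c n i j).toNat → ℤ) (s : ℤ) :
      DRel c n
        (serreSum (1 - dacart c n i j).toNat (fun m => dXp i (rv m)) (dXp j s)
          (fun k => ((-1 : KK) ^ k) * qbinom (dqi c n i) (1 - dacart c n i j).toNat k)) 0
  | serreB_m (i j : Fin n) (hij : i ≠ j) (hi : pid i ≠ n)
      (rv : Fin (1 - dacart c n i j).toNat → ℤ) (s : ℤ) :
      DRel c n
        (serreSum (1 - dacart c n i j).toNat (fun m => dXm i (rv m)) (dXm j s)
          (fun k => ((-1 : KK) ^ k) * qbinom (dqi c n i) (1 - dacart c n i j).toNat k)) 0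
  -- Serre relation (C)
  | serreC_p (i j : Fin n) (hi : pid i = n)
      (hj : (c = Gcase.sl2 ∧ pid j ≠ n) ∨ (c ≠ Gcase.sl2 ∧ pid j + 1 < n))
      (rv : Fin (1 - dacart c n i j).toNat → ℤ) (s : ℤ) :
      DRel c n
        (serreSum (1 - dacart c n i j).toNat (fun m => dXp i (rv m)) (dXp j s)
          (fun k => qbinom (ii * dqi c n i) (1 - dacart c n i j).toNat k)) 0
  | serreC_m (i j : Fin n) (hi : pid i = n)
      (hj : (c = Gcase.sl2 ∧ pid j ≠ n) ∨ (c ≠ Gcase.sl2 ∧ pid j + 1 < n))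
      (rv : Fin (1 - dacart c n i j).toNat → ℤ) (s : ℤ) :
      DRel c n
        (serreSum (1 - dacart c n i j).toNat (fun m => dXm i (rv m)) (dXm j s)
          (fun k => qbinom (ii * dqi c n i) (1 - dacart c n i j).toNat k)) 0
  -- Serre relations (D), only for osp(1|2n)^{(1)}
  | serreD1_p (hc : c = Gcase.osp1) (i : Fin n) (hi : pid i = n) (rv : Fin 3 → ℤ) :
      DRel c n
        (∑ σ : Equiv.Perm (Fin 3),
          sbr 0 1 (qpow 4)
            (sbr 1 1 (qpow 2) (dXp i (rv (σ 0) + 1)) (dXp i (rv (σ 1)))) (dXp i (rv (σ 2)))) 0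
  | serreD1_m (hc : c = Gcase.osp1) (i : Fin n) (hi : pid i = n) (rv : Fin 3 → ℤ) :
      DRel c n
        (∑ σ : Equiv.Perm (Fin 3),
          sbr 0 1 (qpow 4)
            (sbr 1 1 (qpow 2) (dXm i (rv (σ 0) - 1)) (dXm i (rv (σ 1)))) (dXm i (rv (σ 2)))) 0
  | serreD2_p (hc : c = Gcase.osp1) (i : Fin n) (hi : pid i = n) (rv : Fin 2 → ℤ) :
      DRel c n
        (∑ σ : Equiv.Perm (Fin 2),
          (sbr 1 1 (qpow 2) (dXp i (rv (σ 0) + 2)) (dXp i (rv (σ 1))) -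
            qpow 4 • sbr 1 1 (qpow (-6)) (dXp i (rv (σ 0) + 1)) (dXp i (rv (σ 1) + 1)))) 0
  | serreD2_m (hc : c = Gcase.osp1) (i : Fin n) (hi : pid i = n) (rv : Fin 2 → ℤ) :
      DRel c n
        (∑ σ : Equiv.Perm (Fin 2),
          (sbr 1 1 (qpow 2) (dXm i (rv (σ 0) - 2)) (dXm i (rv (σ 1))) -
            qpow 4 • sbr 1 1 (qpow (-6)) (dXm i (rv (σ 0) - 1)) (dXm i (rv (σ 1) - 1)))) 0
  | serreD3_p (hc : c = Gcase.osp1) (i i' : Fin n) (hi : pid i = n) (hi' : pid i' + 1 = n)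
      (rv : Fin 2 → ℤ) (k : ℤ) :
      DRel c n
        (∑ σ : Equiv.Perm (Fin 2),
          (qpow 2 • sbr 0 0 (qpow 4)
              (sbr 1 1 (qpow 2) (dXp i (rv (σ 0) + 1)) (dXp i (rv (σ 1)))) (dXp i' k) +
           (qpow 2 + qpow (-2)) • sbr 1 1 1
              (sbr 0 1 (qpow 2) (dXp i' k) (dXp i (rv (σ 0) + 1))) (dXp i (rv (σ 1))))) 0
  | serreD3_m (hc : c = Gcase.osp1) (i i' : Fin n) (hi : pid i = n) (hi' : pid i' + 1 = n)
      (rv : Fin 2 → ℤ) (k : ℤ) :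
      DRel c n
        (∑ σ : Equiv.Perm (Fin 2),
          (qpow 2 • sbr 0 0 (qpow 4)
              (sbr 1 1 (qpow 2) (dXm i (rv (σ 0) - 1)) (dXm i (rv (σ 1)))) (dXm i' k) +
           (qpow 2 + qpow (-2)) • sbr 1 1 1
              (sbr 0 1 (qpow 2) (dXm i' k) (dXm i (rv (σ 0) - 1))) (dXm i (rv (σ 1))))) 0
  -- Serre relation (E), only for osp(2|2n)^{(2)}
  | serreE_p (hc : c = Gcase.osp2) (i i' : Fin n) (hi : pid i = n) (hi' : pid i' + 1 = n)
      (rv : Fin 2 → ℤ) (k : ℤ) :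
      DRel c n
        (∑ σ : Equiv.Perm (Fin 2),
          sbr 1 1 1 (sbr 0 1 (qpow 2) (dXp i' k) (dXp i (rv (σ 0) + 1))) (dXp i (rv (σ 1)))) 0
  | serreE_m (hc : c = Gcase.osp2) (i i' : Fin n) (hi : pid i = n) (hi' : pid i' + 1 = n)
      (rv : Fin 2 → ℤ) (k : ℤ) :
      DRel c n
        (∑ σ : Equiv.Perm (Fin 2),
          sbr 1 1 1 (sbr 0 1 (qpow 2) (dXm i' k) (dXm i (rv (σ 0) - 1))) (dXm i (rv (σ 1)))) 0

/-- The Drinfeld superalgebra `U_q^D(g)`. -/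
abbrev UqD (c : Gcase) (n : ℕ) : Type := RingQuot (DRel c n)

/-- the quotient map. -/
def dπ (c : Gcase) (n : ℕ) : DF n →ₐ[KK] UqD c n := RingQuot.mkAlgHom KK (DRel c n)

def vXp (c : Gcase) (n : ℕ) (i : Fin n) (r : ℤ) : UqD c n := dπ c n (dXp i r)
def vXm (c : Gcase) (n : ℕ) (i : Fin n) (r : ℤ) : UqD c n := dπ c n (dXm i r)
def vGa (c : Gcase) (n : ℕ) (i : Fin n) : UqD c n := dπ c n (dGa i)
def vGai (c : Gcase) (n : ℕ) (i : Fin n) : UqD c n := dπ c n (dGai i)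
def vKa (c : Gcase) (n : ℕ) (i : Fin n) (s : ℤ) : UqD c n := dπ c n (dKa i s)
def vGh (c : Gcase) (n : ℕ) : UqD c n := dπ c n (dGh n)
def vGhi (c : Gcase) (n : ℕ) : UqD c n := dπ c n (dGhi n)
/-- `γ = (γ^{1/2})²`. -/
def vGam (c : Gcase) (n : ℕ) : UqD c n := vGh c n * vGh c n
/-- `γ⁻¹`. -/
def vGamInv (c : Gcase) (n : ℕ) : UqD c n := vGhi c n * vGhi c n

/-! ## The quantum affine superalgebra `U_q(g)` in the Chevalley presentation -/

/-- Chevalley generators `e_i`, `f_i`, `k_i`, `k_i⁻¹`, `0 ≤ i ≤ n`. -/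
inductive CGen (n : ℕ) : Type
  | e : Fin (n + 1) → CGen n
  | f : Fin (n + 1) → CGen n
  | k : Fin (n + 1) → CGen n
  | ki : Fin (n + 1) → CGen n

abbrev CF (n : ℕ) : Type := FreeAlgebra KK (CGen n)

def cE {n : ℕ} (i : Fin (n + 1)) : CF n := FreeAlgebra.ι KK (CGen.e i)
def cF {n : ℕ} (i : Fin (n + 1)) : CF n := FreeAlgebra.ι KK (CGen.f i)
def cK {n : ℕ} (i : Fin (n + 1)) : CF n := FreeAlgebra.ι KK (CGen.k i)
def cKi {n : ℕ} (i : Fin (n + 1)) : CF n := FreeAlgebra.ι KK (CGen.ki i)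

def cB (c : Gcase) (n : ℕ) (i j : Fin (n + 1)) : ℤ := Bc c n (i : ℕ) (j : ℕ)
def cpar (c : Gcase) (n : ℕ) (i : Fin (n + 1)) : ℕ := pc c n (i : ℕ)
def cqi (c : Gcase) (n : ℕ) (i : Fin (n + 1)) : KK := qpow (cB c n i i)
def cden (c : Gcase) (n : ℕ) (i : Fin (n + 1)) : KK := cqi c n i - (cqi c n i)⁻¹
def cacart (c : Gcase) (n : ℕ) (i j : Fin (n + 1)) : ℤ := 2 * cB c n i j / cB c n i i

/-- `Ad_{e_i}(x) = e_i x − (−1)^{[e_i][x]} k_i x k_i⁻¹ e_i` (`p` = parity of `x`). -/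
def adE (c : Gcase) (n : ℕ) (i : Fin (n + 1)) (p : ℕ) (x : CF n) : CF n :=
  cE i * x - ((-1 : KK) ^ (cpar c n i * p)) • (cK i * x * cKi i * cE i)

/-- `Ad_{f_i}(x) = f_i x − (−1)^{[f_i][x]} k_i⁻¹ x k_i f_i`. -/
def adF (c : Gcase) (n : ℕ) (i : Fin (n + 1)) (p : ℕ) (x : CF n) : CF n :=
  cF i * x - ((-1 : KK) ^ (cpar c n i * p)) • (cKi i * x * cK i * cF i)

/-- `(Ad_{e_i})^m (x)` for `x` of parity `p0` (with parity book-keeping). -/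
def adEiter (c : Gcase) (n : ℕ) (i : Fin (n + 1)) (p0 : ℕ) : ℕ → CF n → CF n
  | 0, x => x
  | (m + 1), x => adE c n i (cpar c n i * m + p0) (adEiter c n i p0 m x)

def adFiter (c : Gcase) (n : ℕ) (i : Fin (n + 1)) (p0 : ℕ) : ℕ → CF n → CF n
  | 0, x => x
  | (m + 1), x => adF c n i (cpar c n i * m + p0) (adFiter c n i p0 m x)

/-- Defining relations of the quantum affine superalgebra `U_q(g)` (Definition 2.1). -/
inductive CRel (c : Gcase) (n : ℕ) : CF n → CF n → Prop
  | k_ki (i : Fin (n + 1)) : CRel c n (cK i * cKi i) 1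
  | ki_k (i : Fin (n + 1)) : CRel c n (cKi i * cK i) 1
  | k_comm (i j : Fin (n + 1)) : CRel c n (cK i * cK j) (cK j * cK i)
  | k_e (i j : Fin (n + 1)) :
      CRel c n (cK i * cE j * cKi i) (qpow (2 * cB c n i j) • cE j)
  | k_f (i j : Fin (n + 1)) :
      CRel c n (cK i * cF j * cKi i) (qpow (-(2 * cB c n i j)) • cF j)
  | e_f (i j : Fin (n + 1)) :
      CRel c n (cE i * cF j - ((-1 : KK) ^ (cpar c n i * cpar c n j)) • (cF j * cE i))
        (if i = j then (cden c n i)⁻¹ • (cK i - cKi i) else 0)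
  | serre_e (i j : Fin (n + 1)) (h : i ≠ j) :
      CRel c n (adEiter c n i (cpar c n j) (1 - cacart c n i j).toNat (cE j)) 0
  | serre_f (i j : Fin (n + 1)) (h : i ≠ j) :
      CRel c n (adFiter c n i (cpar c n j) (1 - cacart c n i j).toNat (cF j)) 0

/-- The quantum affine superalgebra `U_q(g)`. -/
abbrev Uq (c : Gcase) (n : ℕ) : Type := RingQuot (CRel c n)

def cπ (c : Gcase) (n : ℕ) : CF n →ₐ[KK] Uq c n := RingQuot.mkAlgHom KK (CRel c n)

def wE (c : Gcase) (n : ℕ) (i : Fin (n + 1)) : Uq c n := cπ c n (cE i)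
def wF (c : Gcase) (n : ℕ) (i : Fin (n + 1)) : Uq c n := cπ c n (cF i)
def wK (c : Gcase) (n : ℕ) (i : Fin (n + 1)) : Uq c n := cπ c n (cK i)
def wKi (c : Gcase) (n : ℕ) (i : Fin (n + 1)) : Uq c n := cπ c n (cKi i)

/-! ## Adjoint chains in `U_q^D(g)` -/

/-- `Ad_{ξ⁻_{i,0}}(x) = ξ⁻_{i,0} x − (−1)^{[ξ⁻_{i,0}][x]} γ_i⁻¹ x γ_i ξ⁻_{i,0}`. -/
def AdXmQ (c : Gcase) (n : ℕ) (i : Fin n) (p : ℕ) (x : UqD c n) : UqD c n :=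
  vXm c n i 0 * x -
    ((-1 : KK) ^ (dpar n i * p)) • (vGai c n i * x * vGa c n i * vXm c n i 0)

/-- `Ad_{ξ⁺_{i,0}}(x) = ξ⁺_{i,0} x − (−1)^{[ξ⁺_{i,0}][x]} γ_i x γ_i⁻¹ ξ⁺_{i,0}`. -/
def AdXpQ (c : Gcase) (n : ℕ) (i : Fin n) (p : ℕ) (x : UqD c n) : UqD c n :=
  vXp c n i 0 * x -
    ((-1 : KK) ^ (dpar n i * p)) • (vGa c n i * x * vGai c n i * vXp c n i 0)

/-- iterated `Ad_{ξ⁻}` along a list of indices (head applied last), with parity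
book-keeping: `p0` is the parity of the initial element `x`. -/
def adChainM (c : Gcase) (n : ℕ) : List (Fin n) → ℕ → UqD c n → UqD c n
  | [], _, x => x
  | (i :: t), p0, x => AdXmQ c n i ((t.map (dpar n)).sum + p0) (adChainM c n t p0 x)

def adChainP (c : Gcase) (n : ℕ) : List (Fin n) → ℕ → UqD c n → UqD c n
  | [], _, x => x
  | (i :: t), p0, x => AdXpQ c n i ((t.map (dpar n)).sum + p0) (adChainP c n t p0 x)

/-- `m % n` as an element of `Fin n`. -/
def fnat (n : ℕ) [NeZero n] (m : ℕ) : Fin n :=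
  ⟨m % n, Nat.mod_lt _ (Nat.pos_of_ne_zero (NeZero.ne n))⟩

/-! ## The vertex operator (Fock space) representation for `osp(1|2n)^{(1)}` -/

/-- `℘^{1/2} = √−1·q^{1/2}`. -/
def phh : KK := ii * qh
/-- `℘^{m/2}`. -/
def php (m : ℤ) : KK := phh ^ m

/-- The root lattice `Q` of `osp(1|2n)` in coordinates w.r.t. the basis `α_1, …, α_n`. -/
abbrev Qlat (n : ℕ) : Type := Fin n →₀ ℤ

/-- The variables `κ_{i, −(m+1)}` of `S(η⁻)`. -/
abbrev Vars (n : ℕ) : Type := Fin n × ℕ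

/-- `S(η⁻)`. -/
abbrev Spoly (n : ℕ) : Type := MvPolynomial (Vars n) KK

/-- The Fock space `V = S(η⁻) ⊗ ℂ[Q]`, realised as the free `S(η⁻)`-module on `Q`. -/
abbrev Vfock (n : ℕ) : Type := Qlat n →₀ Spoly n

/-- the scalar `u_{i,j,s}(℘^s − ℘^{−s})/(s(q_i−q_i⁻¹)(q_j−q_j⁻¹))`. -/
def Hscal (n : ℕ) (i j : Fin n) (s : ℤ) : KK :=
  du Gcase.osp1 n i j s * (php (2 * s) - php (-(2 * s))) /
    ((s : KK) * dden Gcase.osp1 n i * dden Gcase.osp1 n j)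

/-- The Heisenberg operators `H_i(s)` on `S(η⁻)`: multiplication by `κ_{i,s}` for `s < 0`,
and the derivation with `H_i(s)(κ_{j,r}) = δ_{r,−s}·u_{i,j,s}(℘^s−℘^{−s})/(s(q_i−q_i⁻¹)(q_j−q_j⁻¹))`
for `s > 0`. -/
def Hop (n : ℕ) (i : Fin n) (s : ℤ) : Module.End KK (Spoly n) :=
  if s < 0 then
    LinearMap.mulLeft KK (MvPolynomial.X (R := KK) ((i, (-s - 1).toNat) : Vars n))
  else if 0 < s then
    (MvPolynomial.mkDerivation KK (fun v : Vars n =>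
      if ((v.2 : ℤ) + 1) = s then MvPolynomial.C (Hscal n i v.1 s) else 0)).toLinearMap
  else 0

/-- `{k}_{q_i} = (℘^k − ℘^{−k})/(q_i − q_i⁻¹)`. -/
def brk (n : ℕ) (i : Fin n) (k : ℕ) : KK :=
  (php (2 * (k : ℤ)) - php (-(2 * (k : ℤ)))) / dden Gcase.osp1 n i

/-- The coefficient operators of `exp(Σ_{k≥1} a_k z^{±k})`: `expCoeff a m` is the coefficient
of `z^{±m}`, characterised by the recursion `(m+1)·E_{m+1} = Σ_{k=1}^{m+1} k a_k E_{m+1−k}`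
(the `a_k` commute). -/
def expCoeff {n : ℕ} (a : ℕ → Module.End KK (Spoly n)) : ℕ → Module.End KK (Spoly n)
  | 0 => 1
  | (m + 1) =>
      (((m : KK) + 1))⁻¹ •
        ∑ k ∈ Finset.range (m + 1),
          (((k : ℕ) + 1 : ℕ) : KK) • (a (k + 1) * expCoeff a (m - k))
  decreasing_by exact Nat.lt_succ_of_le (Nat.sub_le m k)

/-- coefficients of `E⁺_i(z) = exp(Σ_{k≥1} (℘^{−k/2}/{k}_{q_i}) H_i(−k) z^k)`. -/
def EEp (n : ℕ) (i : Fin n) : ℕ → Module.End KK (Spoly n) :=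
  expCoeff fun k => (php (-(k : ℤ)) / brk n i k) • Hop n i (-(k : ℤ))
/-- coefficients of `F⁺_i(z) = exp(−Σ_{k≥1} (℘^{−k/2}/{k}_{q_i}) H_i(k) z^{−k})`. -/
def FFp (n : ℕ) (i : Fin n) : ℕ → Module.End KK (Spoly n) :=
  expCoeff fun k => (-(php (-(k : ℤ)) / brk n i k)) • Hop n i (k : ℤ)
/-- coefficients of `E⁻_i(z) = exp(−Σ_{k≥1} (℘^{k/2}/{k}_{q_i}) H_i(−k) z^k)`. -/
def EEm (n : ℕ) (i : Fin n) : ℕ → Module.End KK (Spoly n) :=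
  expCoeff fun k => (-(php ((k : ℤ)) / brk n i k)) • Hop n i (-(k : ℤ))
/-- coefficients of `F⁻_i(z) = exp(Σ_{k≥1} (℘^{k/2}/{k}_{q_i}) H_i(k) z^{−k})`. -/
def FFm (n : ℕ) (i : Fin n) : ℕ → Module.End KK (Spoly n) :=
  expCoeff fun k => (php ((k : ℤ)) / brk n i k) • Hop n i (k : ℤ)

/-- `(α_i, β)` for `β ∈ Q`. -/
def rowB (n : ℕ) (i : Fin n) (β : Qlat n) : ℤ := β.sum fun j m => dB Gcase.osp1 n i j * m

/-- the sign operator `Φ` on `e^β`: `(−1)^{Σ_{k ≥ lo} (α_{k+1}, β)}` (`lo` 0-based). -/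
def phiSgn (n : ℕ) (lo : ℕ) (β : Qlat n) : KK :=
  (-1 : KK) ^ (∑ k ∈ Finset.univ.filter (fun k : Fin n => lo ≤ (k : ℕ)), rowB n k β)

/-- the integer `ℓ(α_i)/2` rounded into the mode convention: `1` for `i < n`, `0` for `i = n`
(where the genuine `ℓ(α_n)/2 = 1/2` is absorbed in the half-integral mode expansion
`X^±_n(z) = Σ_k X^±_n(k) z^{−k±1/2}`). -/
def shiftP (n : ℕ) (i : Fin n) : ℤ := if pid i = n then 0 else 1

/-- the weight of a monomial of `S(η⁻)` (the variable `κ_{i,r}` has weight `−r`). -/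
def wtm (n : ℕ) (m : Vars n →₀ ℕ) : ℕ := m.sum fun v mult => mult * (v.2 + 1)

/-- The mode `X⁺_i(k)` of the vertex operator `X⁺_i(z) = E⁺_i(z) F⁺_i(z) T⁺_i(z)`,
`T⁺_i(z) = e^{α_i} Φ_i z^{∂_{α_i} + ℓ(α_i)/2}`.  On `p ⊗ e^β` only the finitely many terms
with `j ≤ wt(p)` contribute (`F⁺_{i,j}` lowers the weight by `j`). -/
def XpOp (n : ℕ) (i : Fin n) (k : ℤ) : Module.End KK (Vfock n) :=
  Finsupp.lsum KK fun β : Qlat n =>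
    ((MvPolynomial.basisMonomials (Vars n) KK).constr KK fun mono : Vars n →₀ ℕ =>
      phiSgn n (i : ℕ) β •
        Finsupp.single (β + Finsupp.single i 1)
          (∑ j ∈ Finset.range (wtm n mono + 1),
            (if 0 ≤ (j : ℤ) - k - rowB n i β - shiftP n i then
              (EEp n i (((j : ℤ) - k - rowB n i β - shiftP n i).toNat))
                ((FFp n i j) (MvPolynomial.monomial mono 1))
             else 0)))

/-- The mode `X⁻_i(k)` of `X⁻_i(z) = E⁻_i(z) F⁻_i(z) T⁻_i(z)`,
`T⁻_i(z) = e^{−α_i} Φ_{i+1} z^{−∂_{α_i} + ℓ(α_i)/2}`. -/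
def XmOp (n : ℕ) (i : Fin n) (k : ℤ) : Module.End KK (Vfock n) :=
  Finsupp.lsum KK fun β : Qlat n =>
    ((MvPolynomial.basisMonomials (Vars n) KK).constr KK fun mono : Vars n →₀ ℕ =>
      phiSgn n ((i : ℕ) + 1) β •
        Finsupp.single (β - Finsupp.single i 1)
          (∑ j ∈ Finset.range (wtm n mono + 1),
            (if 0 ≤ (j : ℤ) - k + rowB n i β - shiftP n i then
              (EEm n i (((j : ℤ) - k + rowB n i β - shiftP n i).toNat))
                ((FFm n i j) (MvPolynomial.monomial mono 1))
             else 0)))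

/-- The operator `γ_i ↦ ϖ_i σ_i ℘^{∂_{α_i}}`:  `e^β ↦ ϖ_i (−1)^{(α_i,β)} ℘^{(α_i,β)} e^β`. -/
def GaOp (n : ℕ) (i : Fin n) : Module.End KK (Vfock n) :=
  Finsupp.lsum KK fun β : Qlat n =>
    (((if pid i = n then phh⁻¹ else 1) * ((-1 : KK) ^ (rowB n i β)) * php (2 * rowB n i β)) •
      (Finsupp.lsingle β : Spoly n →ₗ[KK] Vfock n))

/-- The operator `κ_{i,s} ↦ H_i(s)` extended to `V`. -/
def KaOp (n : ℕ) (i : Fin n) (s : ℤ) : Module.End KK (Vfock n) :=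
  Finsupp.mapRange.linearMap (Hop n i s)

/-- the scalar `ϱ_i = −{ℓ(α_i)/2}_{q_i}`. -/
def rhoi (n : ℕ) (i : Fin n) : KK :=
  -((php (dB Gcase.osp1 n i i) - php (-(dB Gcase.osp1 n i i))) / dden Gcase.osp1 n i)

/-! ### Exponential series of operators, indexed by `ℤ` -/

/-- The coefficients `expCoeff a m`, extended by zero to negative indices. -/
def expCoeffZ {n : ℕ} (a : ℕ → Module.End KK (Spoly n)) (m : ℤ) : Module.End KK (Spoly n) :=
  if 0 ≤ m then expCoeff a m.toNat else 0

lemma sum_neg_one_pow_smul_add {R M : Type*} [CommRing R] [AddCommGroup M] [Module R M]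
    (G : ℕ → M) (N : ℕ) :
    ∑ r ∈ Finset.range N, (-1 : R) ^ r • (G r + G (r + 1)) = G 0 - (-1 : R) ^ N • G N := by
  induction N with
  | zero => simp
  | succ N ih => rw [Finset.sum_range_succ, ih, pow_succ]; module

section ExpCoeff

variable {n : ℕ} {a b : ℕ → Module.End KK (Spoly n)}

lemma expCoeffZ_of_neg (a : ℕ → Module.End KK (Spoly n)) {m : ℤ} (hm : m < 0) :
    expCoeffZ a m = 0 := if_neg (not_le.mpr hm)

lemma expCoeffZ_natCast (a : ℕ → Module.End KK (Spoly n)) (m : ℕ) :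
    expCoeffZ a m = expCoeff a m := by simp [expCoeffZ]

lemma expCoeffZ_zero (a : ℕ → Module.End KK (Spoly n)) : expCoeffZ a 0 = 1 := by
  simp [expCoeffZ, expCoeff]

lemma smul_expCoeffZ (a : ℕ → Module.End KK (Spoly n)) (N : ℕ) (m : ℤ) (h : m ≤ N) :
    (m : KK) • expCoeffZ a m =
      ∑ r ∈ Finset.range N, ((r : KK) + 1) • (a (r + 1) * expCoeffZ a (m - r - 1)) := by
  rcases lt_or_ge 0 m with hm | hm
  · obtain ⟨t, rfl⟩ : ∃ t : ℕ, m = (t : ℤ) + 1 := ⟨(m - 1).toNat, by omega⟩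
    have hN : Finset.range (t + 1) ⊆ Finset.range N := by
      intro x; simp only [Finset.mem_range]; omega
    rw [← Finset.sum_subset hN]
    · have h0 : ((t : KK) + 1) ≠ 0 := by exact_mod_cast Nat.succ_ne_zero t
      rw [show (t : ℤ) + 1 = ((t + 1 : ℕ) : ℤ) by push_cast; rfl, expCoeffZ_natCast, expCoeff]
      push_cast
      rw [smul_smul, mul_inv_cancel₀ h0, one_smul]
      refine Finset.sum_congr rfl fun r hr => ?_
      have hr' : r ≤ t := by simpa [Nat.lt_succ_iff] using hr
      rw [show (t : ℤ) + 1 - r - 1 = ((t - r : ℕ) : ℤ) by omega, expCoeffZ_natCast]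
    · intro r _ hr
      have hr' : t < r := by simpa [Nat.lt_succ_iff] using hr
      rw [expCoeffZ_of_neg a (by omega), mul_zero, smul_zero]
  · rw [Finset.sum_eq_zero]
    · rcases hm.lt_or_eq with hm | rfl
      · rw [expCoeffZ_of_neg a hm, smul_zero]
      · simp
    · intro r _
      rw [expCoeffZ_of_neg a (by omega), mul_zero, smul_zero]

lemma Commute.expCoeff {x : Module.End KK (Spoly n)} (h : ∀ r, Commute x (a (r + 1))) (m : ℕ) :
    Commute x (expCoeff a m) := by
  induction m using Nat.strong_induction_on with
  | _ m ih =>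
    cases m with
    | zero => rw [_root_.expCoeff]; exact Commute.one_right x
    | succ m =>
      rw [_root_.expCoeff]
      refine Commute.smul_right (Commute.sum_right _ _ _ fun r _ => ?_) _
      exact Commute.smul_right ((h r).mul_right (ih _ (by omega))) _

lemma Commute.expCoeffZ {x : Module.End KK (Spoly n)} (h : ∀ r, Commute x (a (r + 1))) (m : ℤ) :
    Commute x (expCoeffZ a m) := by
  unfold _root_.expCoeffZ
  split_ifs
  · exact Commute.expCoeff h _
  · exact Commute.zero_right x

lemma commute_expCoeffZ (h : ∀ r s, Commute (a (r + 1)) (b (s + 1))) (k m : ℤ) :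
    Commute (expCoeffZ a k) (expCoeffZ b m) :=
  Commute.expCoeffZ (fun s => (Commute.expCoeffZ (fun r => (h r s).symm) k).symm) m

/-- If `[a_r, b_s] = δ_{r,s} c_r`, then `[a_r, ·]` acts on `exp(Σ b_s x^s)` as multiplication
by `c_r x^r`. -/
lemma mul_expCoeffZ {c : ℕ → KK}
    (h : ∀ r s, a (r + 1) * b (s + 1) = b (s + 1) * a (r + 1) + if r = s then c r • 1 else 0)
    (r : ℕ) (m : ℤ) :
    a (r + 1) * expCoeffZ b m =
      expCoeffZ b m * a (r + 1) + c r • expCoeffZ b (m - r - 1) := by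
  rcases lt_or_ge 0 m with hm | hm
  · obtain ⟨t, rfl⟩ : ∃ t : ℕ, m = (t : ℤ) + 1 := ⟨(m - 1).toNat, by omega⟩
    induction t using Nat.strong_induction_on with
    | _ t ih =>
      have ih' : ∀ s : ℕ, a (r + 1) * expCoeffZ b ((t : ℤ) + 1 - s - 1) =
          expCoeffZ b ((t : ℤ) + 1 - s - 1) * a (r + 1) +
            c r • expCoeffZ b ((t : ℤ) + 1 - r - 1 - s - 1) := by
        intro s
        rcases lt_trichotomy t s with hs | rfl | hs
        · rw [expCoeffZ_of_neg b (by omega), expCoeffZ_of_neg b (by omega)]; simp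
        · rw [show (t : ℤ) + 1 - t - 1 = 0 by ring, expCoeffZ_zero,
            expCoeffZ_of_neg b (by omega)]; simp
        · have := ih (t - s - 1) (by omega) (by omega)
          rw [show ((t - s - 1 : ℕ) : ℤ) + 1 = (t : ℤ) + 1 - s - 1 by omega] at this
          rw [this]; congr 3; ring
      have h0 : (((t : ℤ) + 1 : ℤ) : KK) ≠ 0 := by exact_mod_cast Nat.succ_ne_zero t
      apply smul_right_injective _ h0
      simp only
      set N := t + r + 1 with hN
      have e1 := smul_expCoeffZ b N ((t : ℤ) + 1) (by push_cast [hN]; omega)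
      have e2 := smul_expCoeffZ b N ((t : ℤ) + 1 - r - 1) (by push_cast [hN]; omega)
      have key : ∀ s ∈ Finset.range N,
          a (r + 1) * (((s : KK) + 1) • (b (s + 1) * expCoeffZ b ((t : ℤ) + 1 - s - 1))) =
          (((s : KK) + 1) • (b (s + 1) * expCoeffZ b ((t : ℤ) + 1 - s - 1))) * a (r + 1) +
          c r • (((s : KK) + 1) • (b (s + 1) * expCoeffZ b ((t : ℤ) + 1 - r - 1 - s - 1))) +
          if r = s then (((r : KK) + 1) * c r) • expCoeffZ b ((t : ℤ) + 1 - r - 1) else 0 := by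
        intro s _
        rw [mul_smul_comm, ← mul_assoc, h, add_mul, mul_assoc, ih', mul_add, smul_add, smul_add,
          smul_mul_assoc, mul_assoc, mul_smul_comm, smul_comm (c r)]
        congr 1
        split_ifs with hrs
        · subst hrs; simp [smul_smul]
        · simp
      calc (((t : ℤ) + 1 : ℤ) : KK) • (a (r + 1) * expCoeffZ b ((t : ℤ) + 1))
          = a (r + 1) * ((((t : ℤ) + 1 : ℤ) : KK) • expCoeffZ b ((t : ℤ) + 1)) := by
            rw [mul_smul_comm]
        _ = _ := by
            rw [e1, Finset.mul_sum, Finset.sum_congr rfl key, Finset.sum_add_distrib,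
              Finset.sum_add_distrib, ← Finset.sum_mul, ← Finset.smul_sum, ← e1, ← e2,
              Finset.sum_ite_eq, if_pos (by simp [hN]), smul_add, smul_mul_assoc, add_assoc,
              smul_smul, smul_smul, ← add_smul]
            congr 2
            push_cast; ring
  · rcases hm.lt_or_eq with hm | rfl
    · rw [expCoeffZ_of_neg b hm, expCoeffZ_of_neg b (by omega)]; simp
    · rw [expCoeffZ_zero, expCoeffZ_of_neg b (by omega)]; simp

/-- If `[a_r, b_s] = δ_{r,s} (−1)^{r−1}/r`, so that `exp(Σ_r [a_r, b_r] x^r) = 1 + x`, then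
exchanging the two exponential series produces the factor `1 + x`. -/
lemma expCoeffZ_mul_expCoeffZ
    (h : ∀ r s, a (r + 1) * b (s + 1) = b (s + 1) * a (r + 1) +
      if r = s then ((-1) ^ r / ((r : KK) + 1)) • 1 else 0)
    (s m : ℤ) :
    expCoeffZ a s * expCoeffZ b m =
      expCoeffZ b m * expCoeffZ a s + expCoeffZ b (m - 1) * expCoeffZ a (s - 1) := by
  rcases lt_or_ge 0 s with hs | hs
  · obtain ⟨t, rfl⟩ : ∃ t : ℕ, s = (t : ℤ) + 1 := ⟨(s - 1).toNat, by omega⟩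
    induction t using Nat.strong_induction_on with
    | _ t ih =>
      have ih' : ∀ r : ℕ, expCoeffZ a ((t : ℤ) + 1 - r - 1) * expCoeffZ b m =
          expCoeffZ b m * expCoeffZ a ((t : ℤ) + 1 - r - 1) +
            expCoeffZ b (m - 1) * expCoeffZ a ((t : ℤ) + 1 - 1 - r - 1) := by
        intro r
        rcases lt_trichotomy t r with hr | rfl | hr
        · rw [expCoeffZ_of_neg a (by omega), expCoeffZ_of_neg a (by omega)]; simp
        · rw [show (t : ℤ) + 1 - t - 1 = 0 by ring, expCoeffZ_zero,
            expCoeffZ_of_neg a (by omega)]; simp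
        · have := ih (t - r - 1) (by omega) (by omega)
          rw [show ((t - r - 1 : ℕ) : ℤ) + 1 = (t : ℤ) + 1 - r - 1 by omega] at this
          rw [this]; congr 3; ring
      have h0 : (((t : ℤ) + 1 : ℤ) : KK) ≠ 0 := by exact_mod_cast Nat.succ_ne_zero t
      apply smul_right_injective _ h0
      simp only
      have e1 := smul_expCoeffZ a (t + 1) ((t : ℤ) + 1) (by push_cast; omega)
      have e2 := smul_expCoeffZ a (t + 1) ((t : ℤ) + 1 - 1) (by push_cast; omega)
      have tel : ∀ N : ℕ, ∑ r ∈ Finset.range N, (-1 : KK) ^ r •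
          (expCoeffZ b (m - r - 1) * expCoeffZ a ((t : ℤ) + 1 - r - 1) +
            expCoeffZ b (m - (r + 1 : ℕ) - 1) * expCoeffZ a ((t : ℤ) + 1 - (r + 1 : ℕ) - 1)) =
          expCoeffZ b (m - 1) * expCoeffZ a ((t : ℤ) + 1 - 1) -
            (-1 : KK) ^ N • (expCoeffZ b (m - N - 1) * expCoeffZ a ((t : ℤ) + 1 - N - 1)) := by
        intro N
        simpa using sum_neg_one_pow_smul_add (fun r : ℕ =>
          expCoeffZ b (m - r - 1) * expCoeffZ a ((t : ℤ) + 1 - r - 1)) N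
      have key : ∀ r ∈ Finset.range (t + 1),
          (((r : KK) + 1) • (a (r + 1) * expCoeffZ a ((t : ℤ) + 1 - r - 1))) * expCoeffZ b m =
          expCoeffZ b m * (((r : KK) + 1) • (a (r + 1) * expCoeffZ a ((t : ℤ) + 1 - r - 1))) +
          expCoeffZ b (m - 1) *
            (((r : KK) + 1) • (a (r + 1) * expCoeffZ a ((t : ℤ) + 1 - 1 - r - 1))) +
          (-1 : KK) ^ r •
          (expCoeffZ b (m - r - 1) * expCoeffZ a ((t : ℤ) + 1 - r - 1) +
            expCoeffZ b (m - (r + 1 : ℕ) - 1) *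
              expCoeffZ a ((t : ℤ) + 1 - (r + 1 : ℕ) - 1)) := by
        intro r _
        have hr0 : ((r : KK) + 1) ≠ 0 := by exact_mod_cast Nat.succ_ne_zero r
        rw [smul_mul_assoc, mul_assoc, ih', mul_add, ← mul_assoc, ← mul_assoc,
          mul_expCoeffZ h, mul_expCoeffZ h, add_mul, add_mul, smul_add, smul_add, smul_add,
          smul_mul_assoc, smul_mul_assoc, smul_smul, smul_smul, mul_div_cancel₀ _ hr0,
          mul_smul_comm, mul_smul_comm, smul_add, mul_assoc, mul_assoc,
          show m - 1 - (r : ℤ) - 1 = m - (r + 1 : ℕ) - 1 by push_cast; ring,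
          show (t : ℤ) + 1 - 1 - r - 1 = (t : ℤ) + 1 - (r + 1 : ℕ) - 1 by push_cast; ring]
        abel
      calc (((t : ℤ) + 1 : ℤ) : KK) • (expCoeffZ a ((t : ℤ) + 1) * expCoeffZ b m)
          = ((((t : ℤ) + 1 : ℤ) : KK) • expCoeffZ a ((t : ℤ) + 1)) * expCoeffZ b m := by
            rw [smul_mul_assoc]
        _ = _ := by
            rw [e1, Finset.sum_mul, Finset.sum_congr rfl key, Finset.sum_add_distrib,
              Finset.sum_add_distrib, ← Finset.mul_sum, ← Finset.mul_sum, ← e1, ← e2, tel,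
              expCoeffZ_of_neg a (m := (t : ℤ) + 1 - (t + 1 : ℕ) - 1) (by push_cast; omega),
              mul_zero, smul_zero, sub_zero, smul_add, mul_smul_comm, mul_smul_comm, add_assoc]
            congr 1
            rw [← one_smul KK (expCoeffZ b (m - 1) * expCoeffZ a ((t : ℤ) + 1 - 1)), smul_smul,
              smul_smul, ← add_smul]
            congr 1
            push_cast; ring
  · rcases hs.lt_or_eq with hs | rfl
    · rw [expCoeffZ_of_neg a hs, expCoeffZ_of_neg a (by omega)]; simp
    · rw [expCoeffZ_zero, expCoeffZ_of_neg a (by omega)]; simp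

end ExpCoeff

/-! ### Scalars -/

lemma qh_ne_zero : qh ≠ 0 := RatFunc.X_ne_zero

lemma qh_pow_ne_one {m : ℕ} (hm : m ≠ 0) : qh ^ m ≠ 1 := by
  intro h
  have h' : algebraMap (Polynomial ℂ) (RatFunc ℂ) (Polynomial.X ^ m) =
      algebraMap (Polynomial ℂ) (RatFunc ℂ) 1 := by
    rw [map_pow, RatFunc.algebraMap_X, map_one]; exact h
  have h2 := congrArg Polynomial.natDegree (RatFunc.algebraMap_injective ℂ h')
  simp at h2
  exact hm h2

lemma qh_pow_sub_inv_ne_zero {m : ℕ} (hm : m ≠ 0) : qh ^ m - (qh ^ m)⁻¹ ≠ 0 := by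
  intro h
  have h0 : qh ^ m ≠ 0 := pow_ne_zero _ qh_ne_zero
  have h1 : qh ^ m * qh ^ m = 1 := by
    nth_rewrite 1 [sub_eq_zero.mp h]
    exact inv_mul_cancel₀ h0
  rw [← pow_add] at h1
  exact qh_pow_ne_one (by omega) h1

lemma dB_self_pos (n : ℕ) (i : Fin n) : 0 < dB Gcase.osp1 n i i := by
  simp only [dB, Bc, pid]
  split_ifs <;> simp_all

lemma dden_ne_zero (n : ℕ) (i : Fin n) : dden Gcase.osp1 n i ≠ 0 := by
  obtain ⟨d, hd⟩ := Int.eq_ofNat_of_zero_le (dB_self_pos n i).le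
  have hd0 : d ≠ 0 := by
    rintro rfl
    have := dB_self_pos n i
    omega
  simp only [dden, dqi, qpow, hd, zpow_natCast]
  exact qh_pow_sub_inv_ne_zero hd0

lemma ii_mul_ii : ii * ii = -1 := by
  rw [ii, ← map_mul, Complex.I_mul_I, map_neg, map_one]

lemma phh_ne_zero : phh ≠ 0 := by
  refine mul_ne_zero (fun h => ?_) qh_ne_zero
  have := ii_mul_ii
  rw [h] at this
  simp at this

lemma php_two_mul_sub (k : ℕ) :
    php (2 * (k : ℤ)) - php (-(2 * (k : ℤ))) =
      (-1) ^ k * (qh ^ (2 * k) - (qh ^ (2 * k))⁻¹) := by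
  have h : phh ^ (2 * k) = (-1) ^ k * qh ^ (2 * k) := by
    rw [phh, mul_pow, pow_mul ii, pow_two, ii_mul_ii]
  have e : (2 * (k : ℤ)) = ((2 * k : ℕ) : ℤ) := by push_cast; rfl
  have hs : ((-1 : KK) ^ k)⁻¹ = (-1) ^ k := by
    rw [← inv_pow]; norm_num
  rw [php, php, e, zpow_neg, zpow_natCast, h, mul_inv, hs]
  ring

lemma php_neg_mul_php (k : ℤ) : php (-k) * php k = 1 := by
  rw [php, php, zpow_neg, inv_mul_cancel₀ (zpow_ne_zero _ phh_ne_zero)]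

lemma dB_comm (n : ℕ) (i j : Fin n) : dB Gcase.osp1 n i j = dB Gcase.osp1 n j i := by
  simp only [dB, Bc, pid]
  split_ifs <;> simp_all

lemma dB_eq_neg_one_or_zero (n : ℕ) {i j : Fin n} (hij : i ≠ j) :
    dB Gcase.osp1 n i j = -1 ∨ dB Gcase.osp1 n i j = 0 := by
  have : (i : ℕ) ≠ j := fun h => hij (Fin.ext h)
  simp only [dB, Bc, pid]
  split_ifs <;> simp_all

lemma du_of_ne (n : ℕ) {i j : Fin n} (hij : i ≠ j) (r : ℤ) :
    du Gcase.osp1 n i j r =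
      qpow (2 * r * dB Gcase.osp1 n i j) - qpow (-(2 * r * dB Gcase.osp1 n i j)) := by
  have h : ¬(pid i = n ∧ pid j = n) := by
    rintro ⟨h1, h2⟩
    exact hij (Fin.ext (by simp only [pid] at h1 h2; omega))
  simp only [du, uconst, if_neg h, dB]

lemma Hscal_eq_zero (n : ℕ) {i j : Fin n} (hij : i ≠ j) (h : dB Gcase.osp1 n i j = 0) (r : ℤ) :
    Hscal n i j r = 0 := by
  simp [Hscal, du_of_ne n hij, h]

lemma Hscal_div_brk (n : ℕ) {i j : Fin n} (hij : i ≠ j) (h : dB Gcase.osp1 n i j = -1) (r : ℕ) :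
    Hscal n i j ((r : ℤ) + 1) / (brk n i (r + 1) * brk n j (r + 1)) =
      (-1) ^ r / ((r : KK) + 1) := by
  have e : (r : ℤ) + 1 = ((r + 1 : ℕ) : ℤ) := by push_cast; rfl
  have hP := qh_pow_sub_inv_ne_zero (m := 2 * (r + 1)) (by omega)
  have hi := dden_ne_zero n i
  have hj := dden_ne_zero n j
  have hr : ((r : KK) + 1) ≠ 0 := by exact_mod_cast Nat.succ_ne_zero r
  have hs : ((-1 : KK) ^ r) ≠ 0 := pow_ne_zero _ (by simp)
  have hss : ((-1 : KK) ^ r) * (-1) ^ r = 1 := by rw [← mul_pow]; simp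
  have hu : du Gcase.osp1 n i j ((r + 1 : ℕ) : ℤ) =
      -(qh ^ (2 * (r + 1)) - (qh ^ (2 * (r + 1)))⁻¹) := by
    rw [du_of_ne n hij, h, qpow, qpow,
      show 2 * ((r + 1 : ℕ) : ℤ) * -1 = -((2 * (r + 1) : ℕ) : ℤ) by push_cast; ring, neg_neg,
      zpow_neg, zpow_natCast]
    ring
  rw [e, Hscal, brk, brk, php_two_mul_sub, hu]
  generalize qh ^ (2 * (r + 1)) - (qh ^ (2 * (r + 1)))⁻¹ = P at hP
  rw [pow_succ]
  push_cast
  field_simp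
  linear_combination -hss

/-! ### The Heisenberg operators -/

lemma Hop_neg (n : ℕ) (i : Fin n) (r : ℕ) :
    Hop n i (-((r : ℤ) + 1)) = LinearMap.mulLeft KK (MvPolynomial.X (i, r)) := by
  rw [Hop, if_pos (by omega)]
  congr
  omega

lemma Hop_pos (n : ℕ) (i : Fin n) (r : ℕ) :
    Hop n i ((r : ℤ) + 1) = (MvPolynomial.mkDerivation KK (fun v : Vars n =>
      if v.2 = r then MvPolynomial.C (Hscal n i v.1 ((r : ℤ) + 1)) else 0)).toLinearMap := by
  rw [Hop, if_neg (by omega), if_pos (by omega)]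
  congr
  ext v : 1
  simp

lemma Hop_mul_Hop_neg (n : ℕ) (i j : Fin n) (r s : ℕ) :
    Hop n i ((r : ℤ) + 1) * Hop n j (-((s : ℤ) + 1)) =
      Hop n j (-((s : ℤ) + 1)) * Hop n i ((r : ℤ) + 1) +
        if r = s then Hscal n i j ((r : ℤ) + 1) • 1 else 0 := by
  rw [Hop_neg, Hop_pos]
  refine LinearMap.ext fun p => ?_
  simp only [Module.End.mul_apply, LinearMap.mulLeft_apply, Derivation.coeFn_coe, Derivation.leibniz, MvPolynomial.mkDerivation_X, smul_eq_mul,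
    LinearMap.add_apply]
  congr 1
  by_cases h : r = s
  · subst h
    simp [MvPolynomial.smul_eq_C_mul, mul_comm]
  · simp [h, Ne.symm h]

lemma Hop_neg_commute (n : ℕ) (i j : Fin n) (r s : ℕ) :
    Commute (Hop n i (-((r : ℤ) + 1))) (Hop n j (-((s : ℤ) + 1))) := by
  rw [Hop_neg, Hop_neg]
  refine LinearMap.ext fun p => ?_
  simp only [Module.End.mul_apply, LinearMap.mulLeft_apply]
  ring

lemma Hop_pos_commute (n : ℕ) (i j : Fin n) (r s : ℕ) :
    Commute (Hop n i ((r : ℤ) + 1)) (Hop n j ((s : ℤ) + 1)) := by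
  rw [Hop_pos, Hop_pos]
  set D₁ : Derivation KK (Spoly n) (Spoly n) := MvPolynomial.mkDerivation KK (fun v : Vars n =>
    if v.2 = r then MvPolynomial.C (Hscal n i v.1 ((r : ℤ) + 1)) else 0) with hD₁
  set D₂ : Derivation KK (Spoly n) (Spoly n) := MvPolynomial.mkDerivation KK (fun v : Vars n =>
    if v.2 = s then MvPolynomial.C (Hscal n j v.1 ((s : ℤ) + 1)) else 0) with hD₂
  have h : ⁅(D₁ : Derivation KK (Spoly n) (Spoly n)), D₂⁆ = 0 := by
    refine MvPolynomial.derivation_ext fun v => ?_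
    rw [Derivation.commutator_apply, hD₁, hD₂, MvPolynomial.mkDerivation_X,
      MvPolynomial.mkDerivation_X]
    split_ifs <;> simp
  refine LinearMap.ext fun p => sub_eq_zero.mp ?_
  have := congrArg (fun D => D p) h
  simpa [Derivation.commutator_apply] using this

/-! ### Exchange relations for the exponential series -/

lemma EEp_commute_EEm (n : ℕ) (i j : Fin n) (a b : ℤ) :
    Commute
      (expCoeffZ (fun k => (php (-(k : ℤ)) / brk n i k) • Hop n i (-(k : ℤ))) a)
      (expCoeffZ (fun k => (-(php ((k : ℤ)) / brk n j k)) • Hop n j (-(k : ℤ))) b) := by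
  refine commute_expCoeffZ (fun r s => ?_) a b
  push_cast
  exact ((Hop_neg_commute n i j r s).smul_left _).smul_right _

lemma FFp_commute_FFm (n : ℕ) (i j : Fin n) (a b : ℤ) :
    Commute
      (expCoeffZ (fun k => (-(php (-(k : ℤ)) / brk n i k)) • Hop n i (k : ℤ)) a)
      (expCoeffZ (fun k => (php ((k : ℤ)) / brk n j k) • Hop n j (k : ℤ)) b) := by
  refine commute_expCoeffZ (fun r s => ?_) a b
  push_cast
  exact ((Hop_pos_commute n i j r s).smul_left _).smul_right _

lemma smul_Hop_mul_smul_Hop_neg (n : ℕ) (i j : Fin n) (x y : ℕ → KK) (r s : ℕ) :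
    (x (r + 1) • Hop n i ((r + 1 : ℕ) : ℤ)) * (y (s + 1) • Hop n j (-((s + 1 : ℕ) : ℤ))) =
      (y (s + 1) • Hop n j (-((s + 1 : ℕ) : ℤ))) * (x (r + 1) • Hop n i ((r + 1 : ℕ) : ℤ)) +
        if r = s then (x (r + 1) * y (r + 1) * Hscal n i j ((r : ℤ) + 1)) • 1 else 0 := by
  push_cast
  rw [smul_mul_smul_comm, Hop_mul_Hop_neg, smul_mul_smul_comm, smul_add, mul_comm (y _)]
  congr 1
  split_ifs with h
  · subst h; rw [smul_smul]
  · rw [smul_zero]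

/-- Exchange relation for two exponential series whose coefficients `x`, `y` satisfy
`x_k y_k = 1 / ({k}_{q_i} {k}_{q_j})`. -/
lemma exchange_of_mul_eq (n : ℕ) {i j : Fin n} (hij : i ≠ j) (x y : ℕ → KK)
    (hxy : ∀ k, x k * y k = (brk n i k * brk n j k)⁻¹) (a b : ℤ) :
    expCoeffZ (fun k => x k • Hop n i (k : ℤ)) a *
        expCoeffZ (fun k => y k • Hop n j (-(k : ℤ))) b =
      expCoeffZ (fun k => y k • Hop n j (-(k : ℤ))) b *
        expCoeffZ (fun k => x k • Hop n i (k : ℤ)) a +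
      if dB Gcase.osp1 n i j = 0 then 0 else
        expCoeffZ (fun k => y k • Hop n j (-(k : ℤ))) (b - 1) *
          expCoeffZ (fun k => x k • Hop n i (k : ℤ)) (a - 1) := by
  rcases dB_eq_neg_one_or_zero n hij with h | h
  · rw [if_neg (by omega)]
    refine expCoeffZ_mul_expCoeffZ (fun r s => ?_) a b
    rw [smul_Hop_mul_smul_Hop_neg, hxy, ← Hscal_div_brk n hij h r, div_eq_inv_mul]
  · rw [if_pos h, add_zero]
    refine commute_expCoeffZ (fun r s => ?_) a b
    have := smul_Hop_mul_smul_Hop_neg n i j x y r s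
    rw [Hscal_eq_zero n hij h, mul_zero, zero_smul, ite_self, add_zero] at this
    exact this

/-! ### Local nilpotence of the annihilation operators -/

lemma wtm_sub_single (n : ℕ) (m : Vars n →₀ ℕ) (v : Vars n) (hv : m v ≠ 0) :
    wtm n (m - Finsupp.single v 1) + (v.2 + 1) = wtm n m := by
  have hle : Finsupp.single v 1 ≤ m := by
    rw [Finsupp.single_le_iff]; omega
  conv_rhs => rw [← tsub_add_cancel_of_le hle]
  simp only [wtm]
  rw [Finsupp.sum_add_index' (by simp) (by intros; ring), Finsupp.sum_single_index (by simp)]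
  ring

/-- Polynomials all of whose monomials have weight at most `d`. -/
def weightLE (n : ℕ) (d : ℤ) : Submodule KK (Spoly n) :=
  Submodule.span KK ((fun m : Vars n →₀ ℕ => MvPolynomial.monomial m (1 : KK)) ''
    {m | (wtm n m : ℤ) ≤ d})

lemma monomial_mem_weightLE {n : ℕ} {d : ℤ} {m : Vars n →₀ ℕ} (h : (wtm n m : ℤ) ≤ d) (c : KK) :
    MvPolynomial.monomial m c ∈ weightLE n d := by
  have : MvPolynomial.monomial m c = c • MvPolynomial.monomial m (1 : KK) := by
    rw [MvPolynomial.smul_monomial, smul_eq_mul, mul_one]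
  rw [this]
  exact Submodule.smul_mem _ _ (Submodule.subset_span ⟨m, h, rfl⟩)

lemma eq_zero_of_mem_weightLE {n : ℕ} {d : ℤ} (hd : d < 0) {p : Spoly n}
    (hp : p ∈ weightLE n d) : p = 0 := by
  have : {m : Vars n →₀ ℕ | (wtm n m : ℤ) ≤ d} = ∅ := by
    ext m
    simp only [Set.mem_ofPred_eq, Set.mem_empty_iff_false, iff_false]
    omega
  rw [weightLE, this, Set.image_empty, Submodule.span_empty] at hp
  exact (Submodule.mem_bot KK).mp hp

lemma Hop_mem_weightLE {n : ℕ} (i : Fin n) (r : ℕ) {d : ℤ} {p : Spoly n}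
    (hp : p ∈ weightLE n d) : Hop n i ((r : ℤ) + 1) p ∈ weightLE n (d - r - 1) := by
  refine Submodule.span_le (p := (weightLE n (d - r - 1)).comap (Hop n i ((r : ℤ) + 1))) |>.mpr
    ?_ hp
  rintro _ ⟨m, hm, rfl⟩
  have hm' : (wtm n m : ℤ) ≤ d := hm
  rw [SetLike.mem_coe, Submodule.mem_comap, Hop_pos, Derivation.coeFn_coe,
    MvPolynomial.mkDerivation_monomial, one_smul]
  refine Submodule.sum_mem _ fun v hv => ?_
  simp only
  split_ifs with hvr
  · rw [smul_eq_mul, mul_comm, MvPolynomial.C_mul_monomial]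
    refine monomial_mem_weightLE ?_ _
    have := wtm_sub_single n m v (Finsupp.mem_support_iff.mp hv)
    omega
  · rw [smul_zero]
    exact Submodule.zero_mem _

lemma expCoeff_mem_weightLE {n : ℕ} (i : Fin n) (x : ℕ → KK) (j : ℕ) {d : ℤ} {p : Spoly n}
    (hp : p ∈ weightLE n d) :
    expCoeff (fun k => x k • Hop n i (k : ℤ)) j p ∈ weightLE n (d - j) := by
  induction j using Nat.strong_induction_on generalizing d p with
  | _ j ih =>
    cases j with
    | zero => simpa [expCoeff] using hp
    | succ j =>
      rw [expCoeff, LinearMap.smul_apply, LinearMap.sum_apply]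
      refine Submodule.smul_mem _ _ (Submodule.sum_mem _ fun r hr => ?_)
      have hr' : r < j + 1 := Finset.mem_range.mp hr
      rw [LinearMap.smul_apply, Module.End.mul_apply, LinearMap.smul_apply]
      refine Submodule.smul_mem _ _ (Submodule.smul_mem _ _ ?_)
      have h := Hop_mem_weightLE i r (ih (j - r) (by omega) hp)
      rw [show d - ((j - r : ℕ) : ℤ) - r - 1 = d - ((j + 1 : ℕ) : ℤ) by omega] at h
      exact_mod_cast h

lemma expCoeff_monomial_eq_zero {n : ℕ} (i : Fin n) (x : ℕ → KK) {j : ℕ} {m : Vars n →₀ ℕ}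
    (h : wtm n m < j) :
    expCoeff (fun k => x k • Hop n i (k : ℤ)) j (MvPolynomial.monomial m 1) = 0 :=
  eq_zero_of_mem_weightLE (d := (wtm n m : ℤ) - j) (by omega)
    (expCoeff_mem_weightLE i x j (monomial_mem_weightLE le_rfl 1))

/-! ### The polynomial part of the vertex operator modes -/

/-- The operator `Σ_j E_{j−d} F_j` on `S(η⁻)`, where `E` and `F` are exponential series and the
sum is truncated on each monomial at its weight. -/
def modeOp {n : ℕ} (a b : ℕ → Module.End KK (Spoly n)) (d : ℤ) : Module.End KK (Spoly n) :=
  (MvPolynomial.basisMonomials (Vars n) KK).constr KK fun mono : Vars n →₀ ℕ =>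
    ∑ j ∈ Finset.range (wtm n mono + 1),
      expCoeffZ a ((j : ℤ) - d) (expCoeff b j (MvPolynomial.monomial mono 1))

lemma modeOp_monomial {n : ℕ} (a b : ℕ → Module.End KK (Spoly n)) (d : ℤ)
    (mono : Vars n →₀ ℕ) :
    modeOp a b d (MvPolynomial.monomial mono 1) =
      ∑ j ∈ Finset.range (wtm n mono + 1),
        expCoeffZ a ((j : ℤ) - d) (expCoeff b j (MvPolynomial.monomial mono 1)) := by
  have := (MvPolynomial.basisMonomials (Vars n) KK).constr_basis KK (fun mono : Vars n →₀ ℕ =>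
    ∑ j ∈ Finset.range (wtm n mono + 1),
      expCoeffZ a ((j : ℤ) - d) (expCoeff b j (MvPolynomial.monomial mono 1))) mono
  rwa [MvPolynomial.coe_basisMonomials] at this

open Filter in
lemma eventually_expCoeffZ_apply_eq_zero {n : ℕ} {b : ℕ → Module.End KK (Spoly n)}
    (hb : ∀ {j : ℕ} {m : Vars n →₀ ℕ}, wtm n m < j →
      expCoeff b j (MvPolynomial.monomial m 1) = 0) (p : Spoly n) :
    ∀ᶠ N : ℕ in atTop, expCoeffZ b N p = 0 := by
  simp only [expCoeffZ_natCast]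
  induction p using MvPolynomial.induction_on' with
  | monomial u c =>
    filter_upwards [eventually_gt_atTop (wtm n u)] with N hN
    rw [← mul_one c, ← smul_eq_mul, ← MvPolynomial.smul_monomial, map_smul, hb hN, smul_zero]
  | add p q hp hq =>
    filter_upwards [hp, hq] with N h1 h2
    rw [map_add, h1, h2, add_zero]

open Filter in
lemma eventually_modeOp_apply {n : ℕ} (a : ℕ → Module.End KK (Spoly n))
    {b : ℕ → Module.End KK (Spoly n)}
    (hb : ∀ {j : ℕ} {m : Vars n →₀ ℕ}, wtm n m < j →
      expCoeff b j (MvPolynomial.monomial m 1) = 0) (d : ℤ) (p : Spoly n) :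
    ∀ᶠ N : ℕ in atTop, modeOp a b d p =
      ∑ j ∈ Finset.range (N + 1), expCoeffZ a ((j : ℤ) - d) (expCoeffZ b j p) := by
  simp only [expCoeffZ_natCast]
  induction p using MvPolynomial.induction_on' with
  | monomial u c =>
    filter_upwards [eventually_ge_atTop (wtm n u)] with N hN
    rw [← mul_one c, ← smul_eq_mul, ← MvPolynomial.smul_monomial]
    simp only [map_smul]
    rw [← Finset.smul_sum, modeOp_monomial]
    congr 1
    refine Finset.sum_subset (Finset.range_subset_range.mpr (by omega)) fun j _ hj => ?_
    rw [hb (by simpa [Nat.lt_succ_iff] using hj), map_zero]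
  | add p q hp hq =>
    filter_upwards [hp, hq] with N h1 h2
    simp only [map_add, h1, h2, Finset.sum_add_distrib]

lemma sum_range_shift {M : Type*} [AddCommGroup M] (H : ℤ → M) (N : ℕ) (h0 : H (-1) = 0)
    (hN : H N = 0) :
    ∑ a ∈ Finset.range (N + 1), H ((a : ℤ) - 1) = ∑ a ∈ Finset.range (N + 1), H a := by
  rw [Finset.sum_range_succ', Finset.sum_range_succ, hN]
  simp [h0]

/-- Two normally ordered double sums agree when both exchange relations carry the factor `1 + x`
and one of the two orders of the zero modes produces the matching index shift. -/
lemma sum_exchange {K M : Type*} [CommRing K] [AddCommGroup M] [Module K M]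
    (E₁ F₁ E₂ F₂ : ℤ → Module.End K M)
    (hE : ∀ a b, Commute (E₁ a) (E₂ b)) (hF : ∀ a b, Commute (F₁ a) (F₂ b))
    (h₁ : ∀ a b, F₁ a * E₂ b = E₂ b * F₁ a + E₂ (b - 1) * F₁ (a - 1))
    (h₂ : ∀ a b, F₂ a * E₁ b = E₁ b * F₂ a + E₁ (b - 1) * F₂ (a - 1))
    (z₁ : F₁ (-1) = 0) (z₂ : F₂ (-1) = 0) (d e : ℤ) (N : ℕ) (p : M)
    (hp₁ : F₁ N p = 0) (hp₂ : F₂ N p = 0) :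
    ∑ a ∈ Finset.range (N + 1), E₁ ((a : ℤ) - (d + 1))
        (F₁ a (∑ b ∈ Finset.range (N + 1), E₂ ((b : ℤ) - e) (F₂ b p))) =
      ∑ b ∈ Finset.range (N + 1), E₂ ((b : ℤ) - (e + 1))
        (F₂ b (∑ a ∈ Finset.range (N + 1), E₁ ((a : ℤ) - d) (F₁ a p))) := by
  have hE' : ∀ a b x, E₁ a (E₂ b x) = E₂ b (E₁ a x) := fun a b x =>
    LinearMap.congr_fun (hE a b).eq x
  have hF' : ∀ a b x, F₁ a (F₂ b x) = F₂ b (F₁ a x) := fun a b x =>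
    LinearMap.congr_fun (hF a b).eq x
  have h₁' : ∀ a b x, F₁ a (E₂ b x) = E₂ b (F₁ a x) + E₂ (b - 1) (F₁ (a - 1) x) :=
    fun a b x => LinearMap.congr_fun (h₁ a b) x
  have h₂' : ∀ a b x, F₂ a (E₁ b x) = E₁ b (F₂ a x) + E₁ (b - 1) (F₂ (a - 1) x) :=
    fun a b x => LinearMap.congr_fun (h₂ a b) x
  have L : ∀ a b : ℕ, E₁ ((a : ℤ) - (d + 1)) (F₁ a (E₂ ((b : ℤ) - e) (F₂ b p))) =
      E₁ ((a : ℤ) - (d + 1)) (E₂ ((b : ℤ) - e) (F₁ a (F₂ b p))) +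
        E₁ ((a : ℤ) - 1 - d) (E₂ ((b : ℤ) - (e + 1)) (F₁ ((a : ℤ) - 1) (F₂ b p))) := by
    intro a b
    rw [h₁', map_add, show (a : ℤ) - 1 - d = a - (d + 1) by ring,
      show (b : ℤ) - e - 1 = b - (e + 1) by ring]
  have R : ∀ a b : ℕ, E₂ ((b : ℤ) - (e + 1)) (F₂ b (E₁ ((a : ℤ) - d) (F₁ a p))) =
      E₁ ((a : ℤ) - d) (E₂ ((b : ℤ) - (e + 1)) (F₁ a (F₂ b p))) +
        E₁ ((a : ℤ) - (d + 1)) (E₂ ((b : ℤ) - 1 - e) (F₁ a (F₂ ((b : ℤ) - 1) p))) := by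
    intro a b
    rw [h₂', map_add, ← hF', ← hF', ← hE', ← hE',
      show (b : ℤ) - 1 - e = b - (e + 1) by ring, show (a : ℤ) - d - 1 = a - (d + 1) by ring]
  have SL : ∀ b : ℕ, ∑ a ∈ Finset.range (N + 1),
      E₁ ((a : ℤ) - 1 - d) (E₂ ((b : ℤ) - (e + 1)) (F₁ ((a : ℤ) - 1) (F₂ b p))) =
      ∑ a ∈ Finset.range (N + 1),
        E₁ ((a : ℤ) - d) (E₂ ((b : ℤ) - (e + 1)) (F₁ a (F₂ b p))) := fun b =>
    sum_range_shift (fun a => E₁ (a - d) (E₂ ((b : ℤ) - (e + 1)) (F₁ a (F₂ b p)))) N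
      (by simp [z₁]) (by simp [hF', hp₁])
  have SR : ∀ a : ℕ, ∑ b ∈ Finset.range (N + 1),
      E₁ ((a : ℤ) - (d + 1)) (E₂ ((b : ℤ) - 1 - e) (F₁ a (F₂ ((b : ℤ) - 1) p))) =
      ∑ b ∈ Finset.range (N + 1),
        E₁ ((a : ℤ) - (d + 1)) (E₂ ((b : ℤ) - e) (F₁ a (F₂ b p))) := fun a =>
    sum_range_shift (fun b => E₁ ((a : ℤ) - (d + 1)) (E₂ (b - e) (F₁ a (F₂ b p)))) N
      (by simp [z₂]) (by simp [hp₂])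
  simp only [map_sum, L, R, Finset.sum_add_distrib]
  rw [add_comm, Finset.sum_comm]
  simp only [SL]
  congr 1
  exact (Finset.sum_congr rfl fun a _ => (SR a).symm).trans Finset.sum_comm

lemma sum_exchange_of_commute {K M : Type*} [CommRing K] [AddCommGroup M] [Module K M]
    (E₁ F₁ E₂ F₂ : ℤ → Module.End K M)
    (hE : ∀ a b, Commute (E₁ a) (E₂ b)) (hF : ∀ a b, Commute (F₁ a) (F₂ b))
    (h₁ : ∀ a b, Commute (F₁ a) (E₂ b)) (h₂ : ∀ a b, Commute (F₂ a) (E₁ b))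
    (d e : ℤ) (N : ℕ) (p : M) :
    ∑ a ∈ Finset.range (N + 1), E₁ ((a : ℤ) - d)
        (F₁ a (∑ b ∈ Finset.range (N + 1), E₂ ((b : ℤ) - e) (F₂ b p))) =
      ∑ b ∈ Finset.range (N + 1), E₂ ((b : ℤ) - e)
        (F₂ b (∑ a ∈ Finset.range (N + 1), E₁ ((a : ℤ) - d) (F₁ a p))) := by
  simp only [map_sum]
  rw [Finset.sum_comm]
  refine Finset.sum_congr rfl fun b _ => Finset.sum_congr rfl fun a _ => ?_
  have := ((((hE (a - d) (b - e)).mul_right (h₂ b (a - d)).symm)).mul_left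
    ((h₁ a (b - e)).mul_right (hF a b))).eq
  exact LinearMap.congr_fun this p

/-- The polynomial parts of `X⁺_i` and `X⁻_j` commute up to the index shift coming from the
zero modes. -/
lemma modeOp_comm (n : ℕ) {i j : Fin n} (hij : i ≠ j) (d e : ℤ) (p : Spoly n) :
    modeOp (fun k => (php (-(k : ℤ)) / brk n i k) • Hop n i (-(k : ℤ)))
        (fun k => (-(php (-(k : ℤ)) / brk n i k)) • Hop n i (k : ℤ))
        (d - dB Gcase.osp1 n i j)
      (modeOp (fun k => (-(php ((k : ℤ)) / brk n j k)) • Hop n j (-(k : ℤ)))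
        (fun k => (php ((k : ℤ)) / brk n j k) • Hop n j (k : ℤ)) e p) =
    modeOp (fun k => (-(php ((k : ℤ)) / brk n j k)) • Hop n j (-(k : ℤ)))
        (fun k => (php ((k : ℤ)) / brk n j k) • Hop n j (k : ℤ))
        (e - dB Gcase.osp1 n i j)
      (modeOp (fun k => (php (-(k : ℤ)) / brk n i k) • Hop n i (-(k : ℤ)))
        (fun k => (-(php (-(k : ℤ)) / brk n i k)) • Hop n i (k : ℤ)) d p) := by
  have hE := EEp_commute_EEm n i j
  have hF := FFp_commute_FFm n i j
  have h₁ := exchange_of_mul_eq n hij (fun k => -(php (-(k : ℤ)) / brk n i k))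
    (fun k => -(php ((k : ℤ)) / brk n j k)) (fun k => by
      rw [neg_mul_neg, div_mul_div_comm, php_neg_mul_php, one_div])
  have h₂ := exchange_of_mul_eq n hij.symm (fun k => php ((k : ℤ)) / brk n j k)
    (fun k => php (-(k : ℤ)) / brk n i k) (fun k => by
      rw [div_mul_div_comm, mul_comm (php _), php_neg_mul_php, one_div])
  rw [dB_comm n j i] at h₂
  have nF₁ : ∀ {r : ℕ} {m : Vars n →₀ ℕ}, wtm n m < r → _ := fun {r m} h =>
    expCoeff_monomial_eq_zero (m := m) (j := r) i (fun k => -(php (-(k : ℤ)) / brk n i k)) h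
  have nF₂ : ∀ {r : ℕ} {m : Vars n →₀ ℕ}, wtm n m < r → _ := fun {r m} h =>
    expCoeff_monomial_eq_zero (m := m) (j := r) j (fun k => php ((k : ℤ)) / brk n j k) h
  generalize (fun k : ℕ => (php (-(k : ℤ)) / brk n i k) • Hop n i (-(k : ℤ))) = a₁ at *
  generalize (fun k : ℕ => (-(php (-(k : ℤ)) / brk n i k)) • Hop n i (k : ℤ)) = b₁ at *
  generalize (fun k : ℕ => (-(php ((k : ℤ)) / brk n j k)) • Hop n j (-(k : ℤ))) = a₂ at *
  generalize (fun k : ℕ => (php ((k : ℤ)) / brk n j k) • Hop n j (k : ℤ)) = b₂ at *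
  set B := dB Gcase.osp1 n i j with hB
  obtain ⟨N, ⟨⟨c1, c2⟩, c3, c4⟩, c5, c6⟩ :=
    (((eventually_modeOp_apply a₂ nF₂ e p).and (eventually_modeOp_apply a₁ nF₁ d p)).and
      ((eventually_modeOp_apply a₁ nF₁ (d - B) (modeOp a₂ b₂ e p)).and
        (eventually_modeOp_apply a₂ nF₂ (e - B) (modeOp a₁ b₁ d p))) |>.and
      ((eventually_expCoeffZ_apply_eq_zero nF₁ p).and
        (eventually_expCoeffZ_apply_eq_zero nF₂ p))).exists
  rw [c3, c4, c1, c2]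
  rcases dB_eq_neg_one_or_zero n hij with h | h
  · rw [← hB] at h
    simp only [h, sub_neg_eq_add] at h₁ h₂ ⊢
    exact sum_exchange (expCoeffZ a₁) (expCoeffZ b₁) (expCoeffZ a₂) (expCoeffZ b₂) hE hF
      (by simpa using h₁) (by simpa using h₂) (expCoeffZ_of_neg _ (by omega))
      (expCoeffZ_of_neg _ (by omega)) d e N p c5 c6
  · rw [← hB] at h
    simp only [h, sub_zero, if_true, add_zero] at h₁ h₂ ⊢
    exact sum_exchange_of_commute (expCoeffZ a₁) (expCoeffZ b₁) (expCoeffZ a₂) (expCoeffZ b₂)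
      hE hF h₁ h₂ d e N p

/-! ### Action on the lattice part -/

lemma XpOp_single (n : ℕ) (i : Fin n) (k : ℤ) (β : Qlat n) (p : Spoly n) :
    XpOp n i k (Finsupp.single β p) =
      Finsupp.single (β + Finsupp.single i 1) (phiSgn n i β •
        modeOp (fun k => (php (-(k : ℤ)) / brk n i k) • Hop n i (-(k : ℤ)))
          (fun k => (-(php (-(k : ℤ)) / brk n i k)) • Hop n i (k : ℤ))
          (k + rowB n i β + shiftP n i) p) := by
  rw [XpOp, Finsupp.lsum_single]
  set Y := modeOp (fun k => (php (-(k : ℤ)) / brk n i k) • Hop n i (-(k : ℤ)))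
    (fun k => (-(php (-(k : ℤ)) / brk n i k)) • Hop n i (k : ℤ))
    (k + rowB n i β + shiftP n i) with hY
  suffices h : _ = (Finsupp.lsingle (β + Finsupp.single i 1)).comp (phiSgn n i β • Y) from
    LinearMap.congr_fun h p
  refine (MvPolynomial.basisMonomials (Vars n) KK).ext fun mono => ?_
  rw [Module.Basis.constr_basis, MvPolynomial.coe_basisMonomials, LinearMap.comp_apply,
    LinearMap.smul_apply, hY, modeOp_monomial, Finsupp.lsingle_apply, Finsupp.smul_single]
  congr 2
  refine Finset.sum_congr rfl fun j _ => ?_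
  rw [show (j : ℤ) - (k + rowB n i β + shiftP n i) = j - k - rowB n i β - shiftP n i by ring]
  unfold expCoeffZ
  split_ifs <;> rfl

lemma XmOp_single (n : ℕ) (i : Fin n) (k : ℤ) (β : Qlat n) (p : Spoly n) :
    XmOp n i k (Finsupp.single β p) =
      Finsupp.single (β - Finsupp.single i 1) (phiSgn n ((i : ℕ) + 1) β •
        modeOp (fun k => (-(php ((k : ℤ)) / brk n i k)) • Hop n i (-(k : ℤ)))
          (fun k => (php ((k : ℤ)) / brk n i k) • Hop n i (k : ℤ))
          (k - rowB n i β + shiftP n i) p) := by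
  rw [XmOp, Finsupp.lsum_single]
  set Y := modeOp (fun k => (-(php ((k : ℤ)) / brk n i k)) • Hop n i (-(k : ℤ)))
    (fun k => (php ((k : ℤ)) / brk n i k) • Hop n i (k : ℤ))
    (k - rowB n i β + shiftP n i) with hY
  suffices h : _ = (Finsupp.lsingle (β - Finsupp.single i 1)).comp
      (phiSgn n ((i : ℕ) + 1) β • Y) from LinearMap.congr_fun h p
  refine (MvPolynomial.basisMonomials (Vars n) KK).ext fun mono => ?_
  rw [Module.Basis.constr_basis, MvPolynomial.coe_basisMonomials, LinearMap.comp_apply,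
    LinearMap.smul_apply, hY, modeOp_monomial, Finsupp.lsingle_apply, Finsupp.smul_single]
  congr 2
  refine Finset.sum_congr rfl fun j _ => ?_
  rw [show (j : ℤ) - (k - rowB n i β + shiftP n i) = j - k + rowB n i β - shiftP n i by ring]
  unfold expCoeffZ
  split_ifs <;> rfl

lemma rowB_add_single (n : ℕ) (i j : Fin n) (β : Qlat n) (c : ℤ) :
    rowB n i (β + Finsupp.single j c) = rowB n i β + dB Gcase.osp1 n i j * c := by
  unfold rowB
  rw [Finsupp.sum_add_index' (by simp) (by intros; ring), Finsupp.sum_single_index (by simp)]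

lemma rowB_sub_single (n : ℕ) (i j : Fin n) (β : Qlat n) :
    rowB n i (β - Finsupp.single j 1) = rowB n i β - dB Gcase.osp1 n i j := by
  rw [sub_eq_add_neg, ← Finsupp.single_neg, rowB_add_single]
  ring

/-- `Σ_{k ≥ lo} (α_{k+1}, α_{j+1})`. -/
lemma sum_dB (n lo : ℕ) (j : Fin n) (hlo : lo ≤ n) :
    ∑ k ∈ Finset.univ.filter (fun k : Fin n => lo ≤ (k : ℕ)), dB Gcase.osp1 n k j =
      if lo < j then 0 else if lo = j then 1 else if lo = j + 1 ∧ lo < n then -1 else 0 := by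
  set g : ℕ → ℤ := fun x =>
    if x < j then 0 else if x = j then 1 else if x = j + 1 ∧ x < n then -1 else 0 with hg
  have hj := j.isLt
  have step : ∀ k : Fin n, dB Gcase.osp1 n k j = g k - g (k + 1) := by
    intro k
    have hk := k.isLt
    simp only [dB, Bc, pid, hg]
    split_ifs <;> first | omega | tauto
  have tel : ∀ m, lo ≤ m → ∑ k ∈ Finset.range m, (if lo ≤ k then g k - g (k + 1) else 0) =
      g lo - g m := by
    intro m hm
    induction m, hm using Nat.le_induction with
    | base =>
      rw [sub_self]
      exact Finset.sum_eq_zero fun k hk => if_neg (not_le.mpr (Finset.mem_range.mp hk))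
    | succ m hm ih => rw [Finset.sum_range_succ, ih, if_pos hm]; ring
  have gn : g n = 0 := by
    simp only [hg]
    split_ifs <;> omega
  rw [Finset.sum_filter]
  simp only [step]
  rw [Fin.sum_univ_eq_sum_range (fun k => if lo ≤ k then g k - g (k + 1) else 0) n,
    tel n hlo, gn, sub_zero]

lemma phiSgn_add_single (n lo : ℕ) (j : Fin n) (β : Qlat n) (c : ℤ) :
    phiSgn n lo (β + Finsupp.single j c) = phiSgn n lo β * (-1 : KK) ^
      ((∑ k ∈ Finset.univ.filter (fun k : Fin n => lo ≤ (k : ℕ)), dB Gcase.osp1 n k j) * c) := by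
  unfold phiSgn
  rw [← zpow_add₀ (by simp), Finset.sum_mul, ← Finset.sum_add_distrib]
  simp only [rowB_add_single]

/-- The sign operators `Φ` contribute the same sign in both orders. -/
lemma phiSgn_mul_phiSgn (n : ℕ) {i j : Fin n} (hij : i ≠ j) (β : Qlat n) :
    phiSgn n i (β - Finsupp.single j 1) * phiSgn n ((j : ℕ) + 1) β =
      phiSgn n ((j : ℕ) + 1) (β + Finsupp.single i 1) * phiSgn n i β := by
  have hi := i.isLt
  have hj := j.isLt
  have hne : (i : ℕ) ≠ j := fun h => hij (Fin.ext h)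
  rw [sub_eq_add_neg, ← Finsupp.single_neg, phiSgn_add_single, phiSgn_add_single,
    sum_dB n i j hi.le, sum_dB n (j + 1) i (by omega)]
  have key : (-1 : KK) ^ ((if (i : ℕ) < j then 0 else if (i : ℕ) = j then 1 else
        if (i : ℕ) = j + 1 ∧ (i : ℕ) < n then -1 else 0 : ℤ) * -1) =
      (-1 : KK) ^ ((if (j : ℕ) + 1 < i then 0 else if (j : ℕ) + 1 = i then 1 else
        if (j : ℕ) + 1 = i + 1 ∧ (j : ℕ) + 1 < n then -1 else 0 : ℤ) * 1) := by
    congr 1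
    split_ifs <;> omega
  rw [key]
  ring

lemma dpar_mul_dpar (n : ℕ) {i j : Fin n} (hij : i ≠ j) : dpar n i * dpar n j = 0 := by
  have hne : (i : ℕ) ≠ j := fun h => hij (Fin.ext h)
  by_cases h : pid i = n
  · have hj : pid j ≠ n := by
      simp only [pid] at h ⊢
      omega
    rw [dpar, dpar, if_neg hj, mul_zero]
  · rw [dpar, if_neg h, zero_mul]

/-- For `g = osp(1|2n)^{(1)}` and `1 ≤ i, j ≤ n` with `i ≠ j`, the vertex
operators satisfy `[X⁺_i(z), X⁻_j(w)] = 0` (super-commutator); in terms of modes, for all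
`k, l`: `X⁺_i(k) X⁻_j(l) = (−1)^{p_i p_j} X⁻_j(l) X⁺_i(k)`, where `p_m = 1` iff `m = n`. -/
theorem vertex_operator_supercommute (n : ℕ) [NeZero n] (i j : Fin n) (hij : i ≠ j)
    (k l : ℤ) :
    XpOp n i k * XmOp n j l =
      ((-1 : KK) ^ (dpar n i * dpar n j)) • (XmOp n j l * XpOp n i k) := by
  rw [dpar_mul_dpar n hij, pow_zero, one_smul]
  refine Finsupp.lhom_ext fun β p => ?_
  rw [Module.End.mul_apply, Module.End.mul_apply, XmOp_single, XpOp_single, XpOp_single,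
    XmOp_single, map_smul, map_smul, smul_smul, smul_smul, phiSgn_mul_phiSgn n hij,
    rowB_sub_single, rowB_add_single, mul_one, dB_comm n j i]
  have h := modeOp_comm n hij (k + rowB n i β + shiftP n i) (l - rowB n j β + shiftP n j) p
  rw [show k + rowB n i β + shiftP n i - dB Gcase.osp1 n i j =
      k + (rowB n i β - dB Gcase.osp1 n i j) + shiftP n i by ring,
    show l - rowB n j β + shiftP n j - dB Gcase.osp1 n i j =
      l - (rowB n j β + dB Gcase.osp1 n i j) + shiftP n j by ring] at h
  rw [h, show β - Finsupp.single j 1 + Finsupp.single i 1 =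
    β + Finsupp.single i 1 - Finsupp.single j 1 by abel]
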